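/- arXiv:1301.3288 — 3 statements merged into one kernel-verified Lean document; each statement's English description precedes it below -/
import Mathlib

section
/- Let a < b be reals and let G : ℝ → [0,1] be a nondecreasing function with G(x) = 0 for x ≤ a, G(x) = 1 for x ≥ b, and such that G(y) − G(x) ≥ ∫ₓ^y g(u) du for all a ≤ x ≤ y ≤ b, where g is a continuous, strictly positive function on (a,b). Let G_N : ℝ → [0,1] be nondecreasing with G_N(x) = 0 for x < a and sup_x |G_N(x) − G(x)| ≤ ε, 0 < ε < 1/2. Writing H^{−1}(y) := inf{x ∈ ℝ : H(x) ≥ y} for the generalized inverse, then for every δ ∈ (0, (b−a)/2) and every u ∈ (0, 1 − ε]: |G_N^{−1}(u) − G^{−1}(u)| ≤ 2δ + 2ε / inf_{x ∈ [a+δ, b−δ]} g(x). -/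
open Filter Topology

/-- Quantitative estimate from the first part of Corollary 2.3 (bounded support):
if `G` dominates a continuous positive density `g` on `(a,b)`, and `G_N` is within
`ε` of `G` uniformly, then for `δ ∈ (0, (b-a)/2)` and `u ∈ (0, 1-ε]`,
`|G_N⁻¹(u) - G⁻¹(u)| ≤ 2δ + 2ε / inf_{[a+δ, b-δ]} g`. -/
theorem stmt7 (a b : ℝ) (hab : a < b)
    (G GN : ℝ → ℝ) (hG : Monotone G) (hGN : Monotone GN)
    (hGa : ∀ x, x ≤ a → G x = 0) (hGb : ∀ x, b ≤ x → G x = 1)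
    (hG01 : ∀ x, 0 ≤ G x ∧ G x ≤ 1) (hGN01 : ∀ x, 0 ≤ GN x ∧ GN x ≤ 1)
    (g : ℝ → ℝ) (hgcont : ContinuousOn g (Set.Ioo a b))
    (hgpos : ∀ x ∈ Set.Ioo a b, 0 < g x)
    (hdom : ∀ x y, a ≤ x → x ≤ y → y ≤ b → ∫ u in x..y, g u ≤ G y - G x)
    (hGNa : ∀ x, x < a → GN x = 0)
    (ε : ℝ) (hε : 0 < ε) (hε' : ε < 1/2)
    (hclose : ∀ x, |GN x - G x| ≤ ε)
    (inv : (ℝ → ℝ) → ℝ → ℝ) (hinv : ∀ H y, inv H y = sInf {x : ℝ | y ≤ H x}) :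
    ∀ δ ∈ Set.Ioo (0:ℝ) ((b - a) / 2), ∀ u ∈ Set.Ioc (0:ℝ) (1 - ε),
      |inv GN u - inv G u| ≤ 2 * δ + 2 * ε / sInf (g '' Set.Icc (a + δ) (b - δ)) := by
  intro δ hδ u hu
  obtain ⟨hδ0, hδ1⟩ := hδ
  obtain ⟨hu0, hu1⟩ := hu
  have hsub : Set.Icc (a + δ) (b - δ) ⊆ Set.Ioo a b := fun x hx =>
    ⟨by linarith [hx.1], by linarith [hx.2]⟩
  have hne : (Set.Icc (a + δ) (b - δ)).Nonempty := ⟨a + δ, le_refl _, by linarith⟩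
  have hcomp : IsCompact (g '' Set.Icc (a + δ) (b - δ)) :=
    isCompact_Icc.image_of_continuousOn (hgcont.mono hsub)
  set m := sInf (g '' Set.Icc (a + δ) (b - δ)) with hm
  have hmpos : 0 < m := by
    obtain ⟨x, hx, hxm⟩ := hcomp.sInf_mem (hne.image g)
    rw [hm, ← hxm]
    exact hgpos x (hsub hx)
  have hmle : ∀ x ∈ Set.Icc (a + δ) (b - δ), m ≤ g x := fun x hx =>
    csInf_le hcomp.bddBelow ⟨x, hx, rfl⟩
  have key : ∀ s t, a ≤ s → t ≤ b →
      (∀ x y, s < x → x ≤ y → y < t → G y - G x ≤ ε) →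
      t - s ≤ 2 * δ + 2 * ε / m := by
    intro s t hs ht h
    by_contra hcon
    push Not at hcon
    have hr : 0 < ε / m := div_pos hε hmpos
    have hr2 : 2 * ε / m = 2 * (ε / m) := by ring
    have hrm : ε / m * m = ε := div_mul_cancel₀ _ hmpos.ne'
    rw [hr2] at hcon
    set r := ε / m
    obtain ⟨x, hx1, hx2, hx3⟩ : ∃ x, s < x ∧ a + δ ≤ x ∧ x ≤ s + r / 2 + δ :=
      ⟨max (s + r / 2) (a + δ), lt_max_of_lt_left (by linarith), le_max_right _ _,
        max_le (by linarith) (by linarith)⟩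
    obtain ⟨y, hy1, hy2, hy3⟩ : ∃ y, y < t ∧ y ≤ b - δ ∧ t - r / 2 - δ ≤ y :=
      ⟨min (t - r / 2) (b - δ), min_lt_of_left_lt (by linarith), min_le_right _ _,
        le_min (by linarith) (by linarith)⟩
    have hxy : x ≤ y := by linarith
    have h1 := h x y hx1 hxy hy1
    have h2 := hdom x y (by linarith) hxy (by linarith)
    have hsub2 : Set.Icc x y ⊆ Set.Icc (a + δ) (b - δ) := Set.Icc_subset_Icc hx2 hy2
    have h3 : ∫ _ in x..y, m ≤ ∫ u in x..y, g u := by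
      apply intervalIntegral.integral_mono_on hxy
      · exact intervalIntegrable_const
      · apply ContinuousOn.intervalIntegrable
        rw [Set.uIcc_of_le hxy]
        exact hgcont.mono (hsub2.trans hsub)
      · intro z hz
        exact hmle z (hsub2 hz)
    rw [intervalIntegral.integral_const, smul_eq_mul] at h3
    have h4 : r * m < (y - x) * m := mul_lt_mul_of_pos_right (by linarith) hmpos
    linarith
  have inv_facts : ∀ H : ℝ → ℝ, Monotone H → (∀ x, x < a → H x = 0) → u ≤ H b →
      a ≤ inv H u ∧ inv H u ≤ b ∧ (∀ x, x < inv H u → H x < u) ∧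
        (∀ x, inv H u < x → u ≤ H x) := by
    intro H hH hHa hHb
    rw [hinv]
    have hlb : ∀ x ∈ {x : ℝ | u ≤ H x}, a ≤ x := by
      intro x hx
      by_contra hc
      push Not at hc
      have := hHa x hc
      have hx' : u ≤ H x := hx
      linarith
    have hbdd : BddBelow {x : ℝ | u ≤ H x} := ⟨a, hlb⟩
    have hnon : {x : ℝ | u ≤ H x}.Nonempty := ⟨b, hHb⟩
    refine ⟨le_csInf hnon hlb, csInf_le hbdd hHb, ?_, ?_⟩
    · intro x hx
      by_contra hc
      push Not at hc
      exact absurd (csInf_le hbdd hc) (not_le.mpr hx)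
    · intro x hx
      obtain ⟨z, hz, hzx⟩ := exists_lt_of_csInf_lt hnon hx
      exact le_trans hz (hH hzx.le)
  have hb1 := hGb b le_rfl
  have hcb := abs_le.mp (hclose b)
  obtain ⟨p1, p2, p3, p4⟩ := inv_facts GN hGN hGNa (by linarith [hcb.1])
  obtain ⟨q1, q2, q3, q4⟩ := inv_facts G hG (fun x hx => hGa x hx.le) (by linarith)
  rw [abs_le]
  constructor
  · have := key (inv GN u) (inv G u) p1 q2 (by
      intro x y hx hxy hy
      have h1 := p4 x hx
      have h2 := q3 y hy
      have h3 := abs_le.mp (hclose x)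
      linarith [h3.2])
    linarith
  · exact key (inv G u) (inv GN u) q1 p2 (by
      intro x y hx hxy hy
      have h1 := q4 x hx
      have h2 := p3 y hy
      have h3 := abs_le.mp (hclose y)
      linarith [h3.1])
end

section
/- Let a ≥ 0 and let G : ℝ → [0,1] be a distribution function with G(x) = 0 for x ≤ a, such that G(y) − G(x) ≥ ∫ₓ^y g(u) du for all a ≤ x ≤ y < ∞, where g is continuous and strictly positive on (a,∞) and satisfies g(x) ≥ k·x^{−γ} for all x ≥ x₀, for some x₀ > a, k > 0 and γ > 3. Let (G_N) be a sequence of nondecreasing functions G_N : ℝ → [0,1] with G_N(x) = 0 for x < a and ε_N := sup_x |G_N(x) − G(x)| → 0. Writing H^{−1}(y) := inf{x ∈ ℝ : H(x) ≥ y} for the generalized inverse, there exists a sequence x_N → ∞ with x_N ≥ c·ε_N^{−1/(2γ)} for some constant c > 0, such that sup{|G_N^{−1}(u) − G^{−1}(u)| : u ∈ (0,1), G^{−1}(u) ≤ x_N} → 0 as N → ∞. -/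
open Filter Topology

/-- Second part of Corollary 2.3 (unbounded support): if `G` dominates a continuous
positive density `g` on `(a,∞)` with polynomial tail lower bound `g(x) ≥ k x^{-γ}`
(`γ > 3`), and `G_N` is uniformly within `ε_N → 0` of `G`, then there exist `c > 0`
and `x_N → ∞` with `x_N ≥ c ε_N^{-1/(2γ)}` such that
`sup {|G_N⁻¹(u) - G⁻¹(u)| : G⁻¹(u) ≤ x_N} → 0`. -/
theorem stmt8 (a : ℝ) (ha : 0 ≤ a)
    (G : ℝ → ℝ) (hG : Monotone G) (hG01 : ∀ x, 0 ≤ G x ∧ G x ≤ 1)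
    (hGa : ∀ x, x ≤ a → G x = 0) (hGlim : Tendsto G atTop (nhds 1))
    (g : ℝ → ℝ) (hgcont : ContinuousOn g (Set.Ioi a))
    (hgpos : ∀ x ∈ Set.Ioi a, 0 < g x)
    (hdom : ∀ x y, a ≤ x → x ≤ y → ∫ u in x..y, g u ≤ G y - G x)
    (x₀ k γ : ℝ) (hx₀ : a < x₀) (hk : 0 < k) (hγ : 3 < γ)
    (hgtail : ∀ x, x₀ ≤ x → k * x ^ (-γ) ≤ g x)
    (GN : ℕ → ℝ → ℝ) (hGN : ∀ N, Monotone (GN N))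
    (hGN01 : ∀ N x, 0 ≤ GN N x ∧ GN N x ≤ 1)
    (hGNa : ∀ N, ∀ x, x < a → GN N x = 0)
    (ε : ℕ → ℝ) (hεnn : ∀ N, 0 ≤ ε N) (hclose : ∀ N x, |GN N x - G x| ≤ ε N)
    (hεlim : Tendsto ε atTop (nhds 0))
    (inv : (ℝ → ℝ) → ℝ → ℝ) (hinv : ∀ H y, inv H y = sInf {x : ℝ | y ≤ H x}) :
    ∃ c : ℝ, 0 < c ∧ ∃ xN : ℕ → ℝ, Tendsto xN atTop atTop ∧
      (∀ N, c * (ε N) ^ (-(1 / (2 * γ))) ≤ xN N) ∧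
      ∀ η : ℝ, 0 < η → ∃ N₀ : ℕ, ∀ N, N₀ ≤ N → ∀ u ∈ Set.Ioo (0:ℝ) 1,
        inv G u ≤ xN N → |inv (GN N) u - inv G u| ≤ η := by
  have hγ0 : 0 < γ := by linarith
  have key : ∀ p q m : ℝ, a < p → p ≤ q → (∀ w ∈ Set.Icc p q, m ≤ g w) →
      (q - p) * m ≤ G q - G p := by
    intro p q m hp hpq hm
    have h1 := hdom p q hp.le hpq
    have hint : IntervalIntegrable g MeasureTheory.volume p q := by
      apply ContinuousOn.intervalIntegrable
      rw [Set.uIcc_of_le hpq]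
      exact hgcont.mono (fun w hw => lt_of_lt_of_le hp hw.1)
    have h2 : ∫ _ in p..q, m ≤ ∫ u in p..q, g u :=
      intervalIntegral.integral_mono_on hpq (by simp) hint hm
    rw [intervalIntegral.integral_const, smul_eq_mul] at h2
    linarith
  set xN : ℕ → ℝ := fun N => if ε N = 0 then (N : ℝ) else (ε N) ^ (-(1 / (2 * γ))) with hxN
  have hexp : 0 < 1 / (2 * γ) := by positivity
  have hlim : Tendsto xN atTop atTop := by
    rw [tendsto_atTop]
    intro B
    have hB : 0 < max B 1 := by positivity
    have h1 : ∀ᶠ N in atTop, ε N < (max B 1) ^ (-(2 * γ)) :=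
      hεlim.eventually_lt_const (by positivity)
    filter_upwards [h1, eventually_ge_atTop ⌈B⌉₊] with N hN hN2
    simp only [hxN]
    split_ifs with h0
    · exact Nat.ceil_le.mp hN2
    · have hpos : 0 < ε N := lt_of_le_of_ne (hεnn N) (Ne.symm h0)
      have h3 := Real.rpow_le_rpow_of_nonpos hpos hN.le (neg_nonpos.mpr hexp.le)
      rw [← Real.rpow_mul hB.le] at h3
      have : -(2 * γ) * -(1 / (2 * γ)) = 1 := by field_simp
      rw [this, Real.rpow_one] at h3
      exact (le_max_left _ _).trans h3
  refine ⟨1, one_pos, xN, hlim, ?_, ?_⟩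
  · intro N
    simp only [hxN, one_mul]
    split_ifs with h0
    · rw [h0, Real.zero_rpow (by linarith)]
      positivity
    · exact le_rfl
  have main : ∀ η : ℝ, 0 < η → η ≤ 1 → ∃ N₀ : ℕ, ∀ N, N₀ ≤ N → ∀ z, a ≤ z → z ≤ xN N →
      ε N ≤ G (z + η / 2) - G (z + η / 4) := by
    intro η hη hη1
    obtain ⟨m, hm0, hm⟩ : ∃ m : ℝ, 0 < m ∧ ∀ w ∈ Set.Icc (a + η / 4) x₀, m ≤ g w := by
      by_cases hne : (Set.Icc (a + η / 4) x₀).Nonempty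
      · have hsub : Set.Icc (a + η / 4) x₀ ⊆ Set.Ioi a := by
          intro w hw
          have := hw.1
          simp only [Set.mem_Ioi]
          linarith
        obtain ⟨w, hw, hmin⟩ := isCompact_Icc.exists_isMinOn hne (hgcont.mono hsub)
        exact ⟨g w, hgpos w (hsub hw), fun v hv => hmin hv⟩
      · exact ⟨1, one_pos, fun w hw => (hne ⟨w, hw⟩).elim⟩
    have e1 : ∀ᶠ N in atTop, ε N < η / 4 * m := hεlim.eventually_lt_const (by positivity)
    have hC : 0 < η / 4 * (k * 2 ^ (-γ)) := by positivity
    have e2 : ∀ᶠ N in atTop, ε N < (η / 4 * (k * 2 ^ (-γ))) ^ 2 :=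
      hεlim.eventually_lt_const (by positivity)
    have e3 : ∀ᶠ N in atTop, 1 ≤ xN N := hlim.eventually_ge_atTop 1
    obtain ⟨N₀, hN₀⟩ := eventually_atTop.mp (e1.and (e2.and e3))
    refine ⟨N₀, fun N hN z hza hzx => ?_⟩
    obtain ⟨h1, h2, h3⟩ := hN₀ N hN
    rcases (hεnn N).eq_or_lt with h0 | hpos
    · rw [← h0]
      have := hG (show z + η / 4 ≤ z + η / 2 by linarith)
      linarith
    have hxe : xN N = (ε N) ^ (-(1 / (2 * γ))) := by simp [hxN, hpos.ne']
    have hb : ∀ w ∈ Set.Icc (z + η / 4) (z + η / 2), ε N / (η / 4) ≤ g w := by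
      intro w hw
      obtain ⟨hw1, hw2⟩ := hw
      rcases le_total w x₀ with hwx | hwx
      · refine le_trans ?_ (hm w ⟨by linarith, hwx⟩)
        rw [div_le_iff₀ (by positivity)]
        linarith
      · refine le_trans ?_ (hgtail w hwx)
        have hw0 : 0 < w := by linarith
        have h4 : (2 * xN N) ^ (-γ) ≤ w ^ (-γ) :=
          Real.rpow_le_rpow_of_nonpos hw0 (by linarith) (by linarith)
        have h5 : (2 * xN N) ^ (-γ) = 2 ^ (-γ) * Real.sqrt (ε N) := by
          rw [Real.mul_rpow (by norm_num) (by linarith), hxe, ← Real.rpow_mul hpos.le,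
            Real.sqrt_eq_rpow]
          congr 2
          field_simp
        rw [h5] at h4
        have h6 : Real.sqrt (ε N) ≤ η / 4 * (k * 2 ^ (-γ)) :=
          (Real.sqrt_le_left hC.le).mpr h2.le
        have h7 : k * (2 ^ (-γ) * Real.sqrt (ε N)) ≤ k * w ^ (-γ) :=
          mul_le_mul_of_nonneg_left h4 hk.le
        refine le_trans ?_ h7
        rw [div_le_iff₀ (by positivity)]
        have h8 := mul_le_mul_of_nonneg_right h6 (Real.sqrt_nonneg (ε N))
        rw [Real.mul_self_sqrt hpos.le] at h8
        linarith
    have h9 := key _ _ _ (by linarith) (by linarith) hb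
    have : (z + η / 2 - (z + η / 4)) * (ε N / (η / 4)) = ε N := by
      field_simp
      ring
    linarith
  intro η' hη'
  obtain ⟨η, hη, hη1, hηη⟩ : ∃ η : ℝ, 0 < η ∧ η ≤ 1 ∧ η ≤ η' :=
    ⟨min η' 1, by positivity, min_le_right _ _, min_le_left _ _⟩
  obtain ⟨N₀, hN₀⟩ := main η hη hη1
  refine ⟨N₀, fun N hN u hu hux => le_trans ?_ hηη⟩
  obtain ⟨hu0, hu1⟩ := hu
  have hM := hN₀ N hN
  rw [hinv] at hux
  rw [hinv, hinv]
  set x := sInf {x : ℝ | u ≤ G x} with hx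
  have hneG : {x : ℝ | u ≤ G x}.Nonempty := by
    obtain ⟨y, hy⟩ := (hGlim.eventually_const_lt hu1).exists
    exact ⟨y, hy.le⟩
  have hlbG : ∀ y ∈ {x : ℝ | u ≤ G x}, a ≤ y := by
    intro y hy
    by_contra! h
    have hy' : u ≤ G y := hy
    rw [hGa y h.le] at hy'
    linarith
  have hbdG : BddBelow {x : ℝ | u ≤ G x} := ⟨a, hlbG⟩
  have hlbN : ∀ y ∈ {x : ℝ | u ≤ GN N x}, a ≤ y := by
    intro y hy
    by_contra! h
    have hy' : u ≤ GN N y := hy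
    rw [hGNa N y h] at hy'
    linarith
  have hax : a ≤ x := le_csInf hneG hlbG
  have hgt : ∀ y, x < y → u ≤ G y := by
    intro y hy
    obtain ⟨v, hv, hvy⟩ := exists_lt_of_csInf_lt hneG hy
    exact le_trans hv (hG hvy.le)
  have hlt : ∀ y, y < x → G y < u := by
    intro y hy
    by_contra! h
    exact absurd (csInf_le hbdG h) (not_le.mpr hy)
  have hup : x + η ∈ {x : ℝ | u ≤ GN N x} := by
    have h1 := hM x hax hux
    have h2 := hgt (x + η / 4) (by linarith)
    have h3 := hG (show x + η / 2 ≤ x + η by linarith)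
    have h4 := (abs_le.mp (hclose N (x + η))).1
    show u ≤ GN N (x + η)
    linarith
  have h1 : sInf {x : ℝ | u ≤ GN N x} ≤ x + η := csInf_le ⟨a, hlbN⟩ hup
  have h2 : x - η ≤ sInf {x : ℝ | u ≤ GN N x} := by
    refine le_csInf ⟨_, hup⟩ fun y hy => ?_
    rcases lt_or_ge (x - η) a with h | h
    · exact h.le.trans (hlbN y hy)
    · by_contra! hyx
      have h3 := hM (x - η) h (by linarith)
      have h4 := hlt (x - η + η / 2) (by linarith)
      have h5 := hG (show y ≤ x - η + η / 4 by linarith)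
      have h6 := (abs_le.mp (hclose N y)).2
      have h7 : u ≤ GN N y := hy
      linarith
  rw [abs_le]
  constructor <;> linarith
end

section
/- Let n ∈ ℕ, n ≥ 1, and p ∈ [0,1], and let X be a binomially distributed random variable with parameters n and p. Then P[X ≥ n/2] ≤ (4p)^{n/2}. -/
open MeasureTheory

/-- Binomial tail bound from the proof of Lemma 2.4: if `X ~ Bi(n,p)` then
`P[X ≥ n/2] ≤ (4p)^{n/2}`. -/
theorem stmt9 {Ω : Type*} [MeasureSpace Ω]
    [IsProbabilityMeasure (volume : Measure Ω)]
    (n : ℕ) (hn : 1 ≤ n) (p : ℝ) (hp0 : 0 ≤ p) (hp1 : p ≤ 1)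
    (X : Ω → ℕ) (hX : Measurable X)
    (hdist : ∀ k : ℕ,
      volume {ω | X ω = k} = ENNReal.ofReal ((n.choose k : ℝ) * p ^ k * (1 - p) ^ (n - k))) :
    volume {ω | (n : ℝ) / 2 ≤ (X ω : ℝ)} ≤ ENNReal.ofReal ((4 * p) ^ ((n : ℝ) / 2)) := by
  have hsub : {ω | (n : ℝ) / 2 ≤ (X ω : ℝ)} ⊆
      ⋃ k : ℕ, ({ω | (n : ℝ) / 2 ≤ (X ω : ℝ)} ∩ {ω | X ω = k}) := by
    intro ω hω
    exact Set.mem_iUnion.2 ⟨X ω, hω, rfl⟩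
  have hterm : ∀ k : ℕ, volume ({ω | (n : ℝ) / 2 ≤ (X ω : ℝ)} ∩ {ω | X ω = k}) ≤
      ENNReal.ofReal ((n.choose k : ℝ) * p ^ ((n : ℝ) / 2)) := by
    intro k
    by_cases hk : (n : ℝ) / 2 ≤ (k : ℝ)
    · refine (measure_mono Set.inter_subset_right).trans ?_
      rw [hdist k]
      apply ENNReal.ofReal_le_ofReal
      rw [mul_assoc]
      apply mul_le_mul_of_nonneg_left _ (Nat.cast_nonneg _)
      have h1 : (1 - p) ^ (n - k) ≤ 1 := pow_le_one₀ (by linarith) (by linarith)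
      have h2 : p ^ k ≤ p ^ ((n : ℝ) / 2) := by
        rw [← Real.rpow_natCast]
        rcases hp0.eq_or_lt with h | h
        · have hn' : (1 : ℝ) ≤ n := by exact_mod_cast hn
          rw [← h, Real.zero_rpow (by linarith), Real.zero_rpow (by linarith)]
        · exact Real.rpow_le_rpow_of_exponent_ge h hp1 hk
      calc p ^ k * (1 - p) ^ (n - k) ≤ p ^ k * 1 :=
            mul_le_mul_of_nonneg_left h1 (pow_nonneg hp0 k)
        _ ≤ _ := by rw [mul_one]; exact h2
    · have : ({ω | (n : ℝ) / 2 ≤ (X ω : ℝ)} ∩ {ω | X ω = k}) = ∅ := by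
        ext ω
        simp only [Set.mem_inter_iff, Set.mem_setOf_eq, Set.mem_empty_iff_false, iff_false]
        rintro ⟨h1, h2⟩
        rw [h2] at h1
        exact hk h1
      rw [this]
      simp
  have hq : 0 ≤ p ^ ((n : ℝ) / 2) := Real.rpow_nonneg hp0 _
  calc volume {ω | (n : ℝ) / 2 ≤ (X ω : ℝ)}
      ≤ ∑' k : ℕ, volume ({ω | (n : ℝ) / 2 ≤ (X ω : ℝ)} ∩ {ω | X ω = k}) :=
        (measure_mono hsub).trans (measure_iUnion_le _)
    _ ≤ ∑' k : ℕ, ENNReal.ofReal ((n.choose k : ℝ) * p ^ ((n : ℝ) / 2)) :=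
        ENNReal.tsum_le_tsum hterm
    _ = ∑ k ∈ Finset.range (n + 1), ENNReal.ofReal ((n.choose k : ℝ) * p ^ ((n : ℝ) / 2)) := by
        apply tsum_eq_sum
        intro k hk
        rw [Nat.choose_eq_zero_of_lt (by simpa using hk)]
        simp
    _ = ENNReal.ofReal ((4 * p) ^ ((n : ℝ) / 2)) := by
        rw [← ENNReal.ofReal_sum_of_nonneg (fun k _ => mul_nonneg (Nat.cast_nonneg _) hq),
          ← Finset.sum_mul, ← Nat.cast_sum, Nat.sum_range_choose,
          Real.mul_rpow (by norm_num) hp0]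
        congr 2
        rw [show (4 : ℝ) = 2 ^ (2 : ℝ) by norm_num, ← Real.rpow_mul (by norm_num),
          mul_div_cancel₀ _ (by norm_num), Real.rpow_natCast]
        push_cast
        rfl
end
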